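/- arXiv:q-alg/9705017 — 3 statements merged into one kernel-verified Lean document; each statement's English description precedes it below -/
import Mathlib

section
/- Let τ ∈ ℂ with Im τ > 0 and η ∈ ℂ. The fundamental R-matrix R(z,λ) ∈ End(ℂ²⊗ℂ²) satisfies the dynamical Yang–Baxter equation: for all z, w, λ ∈ ℂ at which all entries occurring are defined, R^{(12)}(z−w, λ−2ηh^{(3)}) R^{(13)}(z, λ) R^{(23)}(w, λ−2ηh^{(1)}) = R^{(23)}(w, λ) R^{(13)}(z, λ−2ηh^{(2)}) R^{(12)}(z−w, λ) as endomorphisms of ℂ²⊗ℂ²⊗ℂ². Here h = diag(1,−1) on ℂ² (so the basis vector e_c has h-eigenvalue 1−2c for c ∈ {0,1}), R^{(ab)}(u, λ) acts as R(u,λ) on the a-th and b-th tensor factors and as the identity on the third, and R^{(ab)}(u, λ−2ηh^{(c)}) acts on a vector whose c-th tensor factor is e_{j} as R^{(ab)}(u, λ−2η(1−2j)). -/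
open Complex

/-- The first Jacobi theta function. -/
noncomputable def jacobiTheta1 (t τ : ℂ) : ℂ :=
  -∑' j : ℤ, Complex.exp (Real.pi * I * (j + 1/2) ^ 2 * τ +
    2 * Real.pi * I * (j + 1/2) * (t + 1/2))

noncomputable def alphaRM (τ η z lam : ℂ) : ℂ :=
  jacobiTheta1 (lam + 2 * η) τ * jacobiTheta1 z τ /
    (jacobiTheta1 lam τ * jacobiTheta1 (z - 2 * η) τ)

noncomputable def betaRM (τ η z lam : ℂ) : ℂ :=
  -(jacobiTheta1 (lam + z) τ * jacobiTheta1 (2 * η) τ /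
    (jacobiTheta1 lam τ * jacobiTheta1 (z - 2 * η) τ))

/-- The fundamental R-matrix of `E_{τ,η}(sl₂)` as a matrix on `ℂ²⊗ℂ²` in the
basis `e₀⊗e₀, e₀⊗e₁, e₁⊗e₀, e₁⊗e₁`. -/
noncomputable def fundR (τ η z lam : ℂ) :
    Matrix (Fin 2 × Fin 2) (Fin 2 × Fin 2) ℂ := fun b c =>
  if b = ((0 : Fin 2), (0 : Fin 2)) ∧ c = ((0 : Fin 2), (0 : Fin 2)) then 1
  else if b = ((0 : Fin 2), (1 : Fin 2)) ∧ c = ((0 : Fin 2), (1 : Fin 2)) then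
    alphaRM τ η z lam
  else if b = ((0 : Fin 2), (1 : Fin 2)) ∧ c = ((1 : Fin 2), (0 : Fin 2)) then
    betaRM τ η z lam
  else if b = ((1 : Fin 2), (0 : Fin 2)) ∧ c = ((0 : Fin 2), (1 : Fin 2)) then
    betaRM τ η z (-lam)
  else if b = ((1 : Fin 2), (0 : Fin 2)) ∧ c = ((1 : Fin 2), (0 : Fin 2)) then
    alphaRM τ η z (-lam)
  else if b = ((1 : Fin 2), (1 : Fin 2)) ∧ c = ((1 : Fin 2), (1 : Fin 2)) then 1
  else 0

/-- `R^{(12)}(u, λ(·))` on `ℂ²⊗ℂ²⊗ℂ²`, with the dynamical parameter a function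
of the (spectator) third index. -/
noncomputable def Rop12 (τ η u : ℂ) (lam : Fin 2 → ℂ) :
    Matrix (Fin 2 × Fin 2 × Fin 2) (Fin 2 × Fin 2 × Fin 2) ℂ := fun b c =>
  if b.2.2 = c.2.2 then fundR τ η u (lam c.2.2) (b.1, b.2.1) (c.1, c.2.1) else 0

/-- `R^{(13)}(u, λ(·))`, dynamical parameter a function of the second index. -/
noncomputable def Rop13 (τ η u : ℂ) (lam : Fin 2 → ℂ) :
    Matrix (Fin 2 × Fin 2 × Fin 2) (Fin 2 × Fin 2 × Fin 2) ℂ := fun b c =>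
  if b.2.1 = c.2.1 then fundR τ η u (lam c.2.1) (b.1, b.2.2) (c.1, c.2.2) else 0

/-- `R^{(23)}(u, λ(·))`, dynamical parameter a function of the first index. -/
noncomputable def Rop23 (τ η u : ℂ) (lam : Fin 2 → ℂ) :
    Matrix (Fin 2 × Fin 2 × Fin 2) (Fin 2 × Fin 2 × Fin 2) ℂ := fun b c =>
  if b.1 = c.1 then fundR τ η u (lam c.1) (b.2.1, b.2.2) (c.2.1, c.2.2) else 0

theorem th1_term (t τ : ℂ) (j : ℤ) :
    Complex.exp (Real.pi * I * (j + 1/2) ^ 2 * τ + 2 * Real.pi * I * (j + 1/2) * (t + 1/2)) =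
    Complex.exp (Real.pi * I * τ / 4 + Real.pi * I * (t + 1/2)) *
      jacobiTheta₂_term j (t + 1/2 + τ/2) τ := by
  rw [jacobiTheta₂_term, ← Complex.exp_add]
  congr 1; ring

theorem th1_summable (t τ : ℂ) (hτ : 0 < τ.im) : Summable (fun j : ℤ =>
    Complex.exp (Real.pi * I * (j + 1/2) ^ 2 * τ + 2 * Real.pi * I * (j + 1/2) * (t + 1/2))) := by
  simp_rw [th1_term]
  exact ((summable_jacobiTheta₂_term_iff _ _).2 hτ).mul_left _

/-- even part -/
noncomputable def thE (x τ : ℂ) : ℂ :=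
  ∑' p : ℤ, Complex.exp (Real.pi * I * τ * (2 * p) ^ 2 / 2 + 2 * Real.pi * I * (2 * p) * x)

/-- odd part -/
noncomputable def thO (x τ : ℂ) : ℂ :=
  ∑' p : ℤ, Complex.exp (Real.pi * I * τ * (2 * p + 1) ^ 2 / 2 + 2 * Real.pi * I * (2 * p + 1) * x)

theorem thE_summable (x τ : ℂ) (hτ : 0 < τ.im) : Summable (fun p : ℤ =>
    Complex.exp (Real.pi * I * τ * (2 * p) ^ 2 / 2 + 2 * Real.pi * I * (2 * p) * x)) := by
  have h : 0 < (2 * τ).im := by simpa using hτ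
  refine ((summable_jacobiTheta₂_term_iff (2 * x) _).2 h).congr fun p => ?_
  rw [jacobiTheta₂_term]; congr 1; ring

theorem thO_summable (x τ : ℂ) (hτ : 0 < τ.im) : Summable (fun p : ℤ =>
    Complex.exp (Real.pi * I * τ * (2 * p + 1) ^ 2 / 2 + 2 * Real.pi * I * (2 * p + 1) * x)) := by
  have h : 0 < (2 * τ).im := by simpa using hτ
  refine (((summable_jacobiTheta₂_term_iff (2 * x + τ) _).2 h).mul_left
    (Complex.exp (Real.pi * I * τ / 2 + 2 * Real.pi * I * x))).congr fun p => ?_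
  rw [jacobiTheta₂_term, ← Complex.exp_add]; congr 1; ring

/-- parity splitting of the lattice -/
def parityMap : (ℤ × ℤ) ⊕ (ℤ × ℤ) → ℤ × ℤ
  | Sum.inl (p, q) => (p + q, p - q - 1)
  | Sum.inr (p, q) => (p + q, p - q)

theorem parityMap_bij : Function.Bijective parityMap := by
  constructor
  · rintro (⟨p, q⟩ | ⟨p, q⟩) (⟨r, s⟩ | ⟨r, s⟩) h <;>
      simp only [parityMap, Prod.mk.injEq, Sum.inl.injEq, Sum.inr.injEq, reduceCtorEq] at h ⊢ <;> omega
  · rintro ⟨j, k⟩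
    by_cases h : (j + k) % 2 = 0
    · refine ⟨Sum.inr ((j + k) / 2, (j - k) / 2), ?_⟩
      simp only [parityMap, Prod.mk.injEq]; omega
    · refine ⟨Sum.inl ((j + k + 1) / 2, (j - k - 1) / 2), ?_⟩
      simp only [parityMap, Prod.mk.injEq]; omega

theorem th1_mul (x y τ : ℂ) (hτ : 0 < τ.im) :
    jacobiTheta1 (x + y) τ * jacobiTheta1 (x - y) τ =
      thE x τ * thO y τ - thO x τ * thE y τ := by
  have a1 := (th1_summable (x + y) τ hτ).norm
  have a2 := (th1_summable (x - y) τ hτ).norm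
  have s := summable_mul_of_summable_norm a1 a2
  rw [jacobiTheta1, jacobiTheta1, neg_mul_neg, tsum_mul_tsum_of_summable_norm a1 a2, thE, thO, thO,
    thE, tsum_mul_tsum_of_summable_norm (thE_summable x τ hτ).norm (thO_summable y τ hτ).norm,
    tsum_mul_tsum_of_summable_norm (thO_summable x τ hτ).norm (thE_summable y τ hτ).norm,
    sub_eq_add_neg (∑' _ : ℤ × ℤ, _), ← tsum_neg]
  have s' := (Equiv.ofBijective _ parityMap_bij).summable_iff.2 s
  rw [← (Equiv.ofBijective _ parityMap_bij).tsum_eq]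
  refine (Summable.tsum_sum (s'.comp_injective Sum.inl_injective)
    (s'.comp_injective Sum.inr_injective)).trans ?_
  congr 1
  · refine tsum_congr fun ⟨p, q⟩ => ?_
    simp only [Function.comp_apply, Equiv.ofBijective_apply, parityMap, ← Complex.exp_add]
    rw [Complex.exp_eq_exp_iff_exists_int]
    refine ⟨p, ?_⟩
    push_cast; ring
  · refine tsum_congr fun ⟨p, q⟩ => ?_
    simp only [Function.comp_apply, Equiv.ofBijective_apply, parityMap, ← Complex.exp_add]
    rw [← mul_neg_one (Complex.exp _), ← Complex.exp_pi_mul_I, ← Complex.exp_add,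
      Complex.exp_eq_exp_iff_exists_int]
    refine ⟨p, ?_⟩
    push_cast; ring

theorem th1_three (τ : ℂ) (hτ : 0 < τ.im) (x y u v : ℂ) :
    jacobiTheta1 (x + y) τ * jacobiTheta1 (x - y) τ *
      (jacobiTheta1 (u + v) τ * jacobiTheta1 (u - v) τ) -
    jacobiTheta1 (x + v) τ * jacobiTheta1 (x - v) τ *
      (jacobiTheta1 (u + y) τ * jacobiTheta1 (u - y) τ) =
    jacobiTheta1 (x + u) τ * jacobiTheta1 (x - u) τ *
      (jacobiTheta1 (y + v) τ * jacobiTheta1 (y - v) τ) := by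
  simp only [th1_mul _ _ τ hτ]; ring

theorem th1_odd (τ l : ℂ) (hτ : 0 < τ.im) (hl : jacobiTheta1 l τ ≠ 0) (t : ℂ) :
    jacobiTheta1 (-t) τ = - jacobiTheta1 t τ := by
  have e1 := th1_mul ((l + t) / 2) ((l - t) / 2) τ hτ
  have e2 := th1_mul ((l - t) / 2) ((l + t) / 2) τ hτ
  rw [show (l + t) / 2 + (l - t) / 2 = l by ring, show (l + t) / 2 - (l - t) / 2 = t by ring] at e1
  rw [show (l - t) / 2 + (l + t) / 2 = l by ring, show (l - t) / 2 - (l + t) / 2 = -t by ring] at e2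
  apply mul_left_cancel₀ hl
  linear_combination e1 + e2

theorem th1_tt (τ : ℂ) (hτ : 0 < τ.im) (x y u v : ℂ) {a1 a2 a3 a4 a5 a6 a7 a8 a9 a10 a11 a12 : ℂ}
    (h1 : x + y = a1 := by ring) (h2 : x - y = a2 := by ring) (h3 : u + v = a3 := by ring) (h4 : u - v = a4 := by ring)
    (h5 : x + v = a5 := by ring) (h6 : x - v = a6 := by ring) (h7 : u + y = a7 := by ring) (h8 : u - y = a8 := by ring)
    (h9 : x + u = a9 := by ring) (h10 : x - u = a10 := by ring) (h11 : y + v = a11 := by ring) (h12 : y - v = a12 := by ring) :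
    jacobiTheta1 a1 τ * jacobiTheta1 a2 τ * (jacobiTheta1 a3 τ * jacobiTheta1 a4 τ) -
    jacobiTheta1 a5 τ * jacobiTheta1 a6 τ * (jacobiTheta1 a7 τ * jacobiTheta1 a8 τ) =
    jacobiTheta1 a9 τ * jacobiTheta1 a10 τ * (jacobiTheta1 a11 τ * jacobiTheta1 a12 τ) := by
  subst_vars; exact th1_three τ hτ x y u v

theorem alphaRM_eq (τ η z l A C D : ℂ) (hA : l + 2 * η = A := by ring) (hC : l = C := by ring) (hD : z - 2 * η = D := by ring) :
    alphaRM τ η z l = jacobiTheta1 A τ * jacobiTheta1 z τ /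
      (jacobiTheta1 C τ * jacobiTheta1 D τ) := by
  subst_vars; rfl

theorem betaRM_eq (τ η z l A C D : ℂ) (hA : l + z = A := by ring) (hC : l = C := by ring) (hD : z - 2 * η = D := by ring) :
    betaRM τ η z l = -(jacobiTheta1 A τ * jacobiTheta1 (2 * η) τ /
      (jacobiTheta1 C τ * jacobiTheta1 D τ)) := by
  subst_vars; rfl

theorem dybe1 (τ η z w l lm : ℂ) (hτ : 0 < τ.im) (hlm : lm = l - 2 * η)
    (h1 : jacobiTheta1 l τ ≠ 0) (h3 : jacobiTheta1 (l - 2 * η) τ ≠ 0)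
    (h7 : jacobiTheta1 (z - w - 2 * η) τ ≠ 0) (h8 : jacobiTheta1 (z - 2 * η) τ ≠ 0)
    (h9 : jacobiTheta1 (w - 2 * η) τ ≠ 0) :
    alphaRM τ η z l * alphaRM τ η w lm =
      alphaRM τ η w l * alphaRM τ η z lm := by
  subst hlm
  have odd := th1_odd τ l hτ h1
  rw [alphaRM_eq τ η z l (l + 2 * η) (l) (z - 2 * η)]
  rw [alphaRM_eq τ η w (l - 2 * η) (l) (l - 2 * η) (w - 2 * η)]
  rw [alphaRM_eq τ η w l (l + 2 * η) (l) (w - 2 * η)]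
  rw [alphaRM_eq τ η z (l - 2 * η) (l) (l - 2 * η) (z - 2 * η)]
  try simp only [odd]
  field_simp

theorem dybe2 (τ η z w l lm : ℂ) (hτ : 0 < τ.im) (hlm : lm = l - 2 * η)
    (h1 : jacobiTheta1 l τ ≠ 0) (h3 : jacobiTheta1 (l - 2 * η) τ ≠ 0)
    (h7 : jacobiTheta1 (z - w - 2 * η) τ ≠ 0) (h8 : jacobiTheta1 (z - 2 * η) τ ≠ 0)
    (h9 : jacobiTheta1 (w - 2 * η) τ ≠ 0) :
    alphaRM τ η z l * betaRM τ η w lm =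
      alphaRM τ η w l * betaRM τ η z lm * betaRM τ η (z - w) (-l) + betaRM τ η w l * alphaRM τ η (z - w) l := by
  subst hlm
  have odd := th1_odd τ l hτ h1
  rw [alphaRM_eq τ η z l (l + 2 * η) (l) (z - 2 * η)]
  rw [betaRM_eq τ η w (l - 2 * η) (l + w - 2 * η) (l - 2 * η) (w - 2 * η)]
  rw [alphaRM_eq τ η w l (l + 2 * η) (l) (w - 2 * η)]
  rw [betaRM_eq τ η z (l - 2 * η) (l + z - 2 * η) (l - 2 * η) (z - 2 * η)]
  rw [betaRM_eq τ η (z - w) (-l) (-(l - z + w)) (-(l)) (z - w - 2 * η)]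
  rw [betaRM_eq τ η w l (l + w) (l) (w - 2 * η)]
  rw [alphaRM_eq τ η (z - w) l (l + 2 * η) (l) (z - w - 2 * η)]
  try simp only [odd]
  have k := th1_tt τ hτ (z - (1/2) * w - (1/2) * (2 * η)) (-((1/2) * w) - (1/2) * (2 * η)) (l + (1/2) * w - (1/2) * (2 * η)) (-((1/2) * w) + (1/2) * (2 * η))
    (a1 := z - w - 2 * η)
    (a2 := z)
    (a3 := l)
    (a4 := l + w - 2 * η)
    (a5 := z - w)
    (a6 := z - 2 * η)
    (a7 := l - 2 * η)
    (a8 := l + w)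
    (a9 := l + z - 2 * η)
    (a10 := -(l - z + w))
    (a11 := -(w))
    (a12 := -(2 * η))
  simp only [odd] at k
  linear_combination (norm := skip) ((-1) * jacobiTheta1 (2 * η) τ * jacobiTheta1 (l + 2 * η) τ / (jacobiTheta1 (w - 2 * η) τ * jacobiTheta1 (z - w - 2 * η) τ * jacobiTheta1 (z - 2 * η) τ * jacobiTheta1 (l - 2 * η) τ * jacobiTheta1 (l) τ * jacobiTheta1 (l) τ)) * k
  field_simp
  try ring

theorem dybe3 (τ η z w l lm : ℂ) (hτ : 0 < τ.im) (hlm : lm = l - 2 * η)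
    (h1 : jacobiTheta1 l τ ≠ 0) (h3 : jacobiTheta1 (l - 2 * η) τ ≠ 0)
    (h7 : jacobiTheta1 (z - w - 2 * η) τ ≠ 0) (h8 : jacobiTheta1 (z - 2 * η) τ ≠ 0)
    (h9 : jacobiTheta1 (w - 2 * η) τ ≠ 0) :
    betaRM τ η z l =
      alphaRM τ η w l * betaRM τ η z lm * alphaRM τ η (z - w) (-l) + betaRM τ η w l * betaRM τ η (z - w) l := by
  subst hlm
  have odd := th1_odd τ l hτ h1
  rw [betaRM_eq τ η z l (l + z) (l) (z - 2 * η)]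
  rw [alphaRM_eq τ η w l (l + 2 * η) (l) (w - 2 * η)]
  rw [betaRM_eq τ η z (l - 2 * η) (l + z - 2 * η) (l - 2 * η) (z - 2 * η)]
  rw [alphaRM_eq τ η (z - w) (-l) (-(l - 2 * η)) (-(l)) (z - w - 2 * η)]
  rw [betaRM_eq τ η w l (l + w) (l) (w - 2 * η)]
  rw [betaRM_eq τ η (z - w) l (l + z - w) (l) (z - w - 2 * η)]
  try simp only [odd]
  have k := th1_tt τ hτ ((1/2) * z - 2 * η) (-((1/2) * z) + w) (l + (1/2) * z) (-((1/2) * z))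
    (a1 := w - 2 * η)
    (a2 := z - w - 2 * η)
    (a3 := l)
    (a4 := l + z)
    (a5 := -(2 * η))
    (a6 := z - 2 * η)
    (a7 := l + w)
    (a8 := l + z - w)
    (a9 := l + z - 2 * η)
    (a10 := -(l + 2 * η))
    (a11 := -(z - w))
    (a12 := w)
  simp only [odd] at k
  linear_combination (norm := skip) ((-1) * jacobiTheta1 (2 * η) τ / (jacobiTheta1 (w - 2 * η) τ * jacobiTheta1 (z - w - 2 * η) τ * jacobiTheta1 (z - 2 * η) τ * jacobiTheta1 (l) τ * jacobiTheta1 (l) τ)) * k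
  field_simp
  try ring

theorem dybe4 (τ η z w l lm : ℂ) (hτ : 0 < τ.im) (hlm : lm = l - 2 * η)
    (h1 : jacobiTheta1 l τ ≠ 0) (h3 : jacobiTheta1 (l - 2 * η) τ ≠ 0)
    (h7 : jacobiTheta1 (z - w - 2 * η) τ ≠ 0) (h8 : jacobiTheta1 (z - 2 * η) τ ≠ 0)
    (h9 : jacobiTheta1 (w - 2 * η) τ ≠ 0) :
    alphaRM τ η (z - w) lm * betaRM τ η w (-lm) + betaRM τ η (z - w) lm * betaRM τ η z (-l) * alphaRM τ η w lm =
      betaRM τ η w (-l) * alphaRM τ η z lm := by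
  subst hlm
  have odd := th1_odd τ l hτ h1
  rw [alphaRM_eq τ η (z - w) (l - 2 * η) (l) (l - 2 * η) (z - w - 2 * η)]
  rw [betaRM_eq τ η w (-(l - 2 * η)) (-(l - w - 2 * η)) (-(l - 2 * η)) (w - 2 * η)]
  rw [betaRM_eq τ η (z - w) (l - 2 * η) (l + z - w - 2 * η) (l - 2 * η) (z - w - 2 * η)]
  rw [betaRM_eq τ η z (-l) (-(l - z)) (-(l)) (z - 2 * η)]
  rw [alphaRM_eq τ η w (l - 2 * η) (l) (l - 2 * η) (w - 2 * η)]
  rw [betaRM_eq τ η w (-l) (-(l - w)) (-(l)) (w - 2 * η)]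
  rw [alphaRM_eq τ η z (l - 2 * η) (l) (l - 2 * η) (z - 2 * η)]
  try simp only [odd]
  have k := th1_tt τ hτ (z - (1/2) * w - (1/2) * (2 * η)) (-((1/2) * w) + (1/2) * (2 * η)) (l - (1/2) * w - (1/2) * (2 * η)) (-((1/2) * w) - (1/2) * (2 * η))
    (a1 := z - w)
    (a2 := z - 2 * η)
    (a3 := l - w - 2 * η)
    (a4 := l)
    (a5 := z - w - 2 * η)
    (a6 := z)
    (a7 := l - w)
    (a8 := l - 2 * η)
    (a9 := l + z - w - 2 * η)
    (a10 := -(l - z))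
    (a11 := -(w))
    (a12 := 2 * η)
  simp only [odd] at k
  linear_combination (norm := skip) ((-1) * jacobiTheta1 (2 * η) τ / (jacobiTheta1 (w - 2 * η) τ * jacobiTheta1 (z - w - 2 * η) τ * jacobiTheta1 (z - 2 * η) τ * jacobiTheta1 (l - 2 * η) τ * jacobiTheta1 (l - 2 * η) τ)) * k
  field_simp
  try ring

theorem dybe5 (τ η z w l lm : ℂ) (hτ : 0 < τ.im) (hlm : lm = l - 2 * η)
    (h1 : jacobiTheta1 l τ ≠ 0) (h3 : jacobiTheta1 (l - 2 * η) τ ≠ 0)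
    (h7 : jacobiTheta1 (z - w - 2 * η) τ ≠ 0) (h8 : jacobiTheta1 (z - 2 * η) τ ≠ 0)
    (h9 : jacobiTheta1 (w - 2 * η) τ ≠ 0) :
    alphaRM τ η (z - w) lm * alphaRM τ η w (-lm) + betaRM τ η (z - w) lm * betaRM τ η z (-l) * betaRM τ η w lm =
      betaRM τ η w (-l) * betaRM τ η z lm * betaRM τ η (z - w) (-l) + alphaRM τ η w (-l) * alphaRM τ η (z - w) l := by
  subst hlm
  have odd := th1_odd τ l hτ h1
  rw [alphaRM_eq τ η (z - w) (l - 2 * η) (l) (l - 2 * η) (z - w - 2 * η)]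
  rw [alphaRM_eq τ η w (-(l - 2 * η)) (-(l - 2 * (2 * η))) (-(l - 2 * η)) (w - 2 * η)]
  rw [betaRM_eq τ η (z - w) (l - 2 * η) (l + z - w - 2 * η) (l - 2 * η) (z - w - 2 * η)]
  rw [betaRM_eq τ η z (-l) (-(l - z)) (-(l)) (z - 2 * η)]
  rw [betaRM_eq τ η w (l - 2 * η) (l + w - 2 * η) (l - 2 * η) (w - 2 * η)]
  rw [betaRM_eq τ η w (-l) (-(l - w)) (-(l)) (w - 2 * η)]
  rw [betaRM_eq τ η z (l - 2 * η) (l + z - 2 * η) (l - 2 * η) (z - 2 * η)]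
  rw [betaRM_eq τ η (z - w) (-l) (-(l - z + w)) (-(l)) (z - w - 2 * η)]
  rw [alphaRM_eq τ η w (-l) (-(l - 2 * η)) (-(l)) (w - 2 * η)]
  rw [alphaRM_eq τ η (z - w) l (l + 2 * η) (l) (z - w - 2 * η)]
  try simp only [odd]
  have k := th1_tt τ hτ (l - 2 * η) (-(2 * η)) (l) (0)
    (a1 := l - 2 * (2 * η))
    (a2 := l)
    (a3 := l)
    (a4 := l)
    (a5 := l - 2 * η)
    (a6 := l - 2 * η)
    (a7 := l - 2 * η)
    (a8 := l + 2 * η)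
    (a9 := 2 * l - 2 * η)
    (a10 := -(2 * η))
    (a11 := -(2 * η))
    (a12 := -(2 * η))
  simp only [odd] at k
  have k2 := th1_tt τ hτ (l - (1/2) * z) (-((1/2) * z)) (l + (1/2) * z - 2 * η) (-((1/2) * z) + w)
    (a1 := l - z)
    (a2 := l)
    (a3 := l + w - 2 * η)
    (a4 := l + z - w - 2 * η)
    (a5 := l - z + w)
    (a6 := l - w)
    (a7 := l - 2 * η)
    (a8 := l + z - 2 * η)
    (a9 := 2 * l - 2 * η)
    (a10 := -(z - 2 * η))
    (a11 := -(z - w))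
    (a12 := -(w))
  simp only [odd] at k2
  linear_combination (norm := skip) ((1) * jacobiTheta1 (w) τ * jacobiTheta1 (z - w) τ / (jacobiTheta1 (w - 2 * η) τ * jacobiTheta1 (z - w - 2 * η) τ * jacobiTheta1 (l - 2 * η) τ * jacobiTheta1 (l - 2 * η) τ * jacobiTheta1 (l) τ * jacobiTheta1 (l) τ)) * k +
    ((-1) * jacobiTheta1 (2 * η) τ * jacobiTheta1 (2 * η) τ * jacobiTheta1 (2 * η) τ / (jacobiTheta1 (w - 2 * η) τ * jacobiTheta1 (z - w - 2 * η) τ * jacobiTheta1 (z - 2 * η) τ * jacobiTheta1 (l - 2 * η) τ * jacobiTheta1 (l - 2 * η) τ * jacobiTheta1 (l) τ * jacobiTheta1 (l) τ)) * k2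
  field_simp
  try ring

theorem dybe6 (τ η z w l lm : ℂ) (hτ : 0 < τ.im) (hlm : lm = l - 2 * η)
    (h1 : jacobiTheta1 l τ ≠ 0) (h3 : jacobiTheta1 (l - 2 * η) τ ≠ 0)
    (h7 : jacobiTheta1 (z - w - 2 * η) τ ≠ 0) (h8 : jacobiTheta1 (z - 2 * η) τ ≠ 0)
    (h9 : jacobiTheta1 (w - 2 * η) τ ≠ 0) :
    betaRM τ η (z - w) lm * alphaRM τ η z (-l) =
      betaRM τ η w (-l) * betaRM τ η z lm * alphaRM τ η (z - w) (-l) + alphaRM τ η w (-l) * betaRM τ η (z - w) l := by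
  subst hlm
  have odd := th1_odd τ l hτ h1
  rw [betaRM_eq τ η (z - w) (l - 2 * η) (l + z - w - 2 * η) (l - 2 * η) (z - w - 2 * η)]
  rw [alphaRM_eq τ η z (-l) (-(l - 2 * η)) (-(l)) (z - 2 * η)]
  rw [betaRM_eq τ η w (-l) (-(l - w)) (-(l)) (w - 2 * η)]
  rw [betaRM_eq τ η z (l - 2 * η) (l + z - 2 * η) (l - 2 * η) (z - 2 * η)]
  rw [alphaRM_eq τ η (z - w) (-l) (-(l - 2 * η)) (-(l)) (z - w - 2 * η)]
  rw [alphaRM_eq τ η w (-l) (-(l - 2 * η)) (-(l)) (w - 2 * η)]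
  rw [betaRM_eq τ η (z - w) l (l + z - w) (l) (z - w - 2 * η)]
  try simp only [odd]
  have k := th1_tt τ hτ ((1/2) * z + (1/2) * w - (1/2) * (2 * η)) (-((1/2) * z) + (1/2) * w - (1/2) * (2 * η)) (l + (1/2) * z - (1/2) * w - (1/2) * (2 * η)) (-((1/2) * z) + (1/2) * w + (1/2) * (2 * η))
    (a1 := w - 2 * η)
    (a2 := z)
    (a3 := l)
    (a4 := l + z - w - 2 * η)
    (a5 := w)
    (a6 := z - 2 * η)
    (a7 := l - 2 * η)
    (a8 := l + z - w)
    (a9 := l + z - 2 * η)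
    (a10 := -(l - w))
    (a11 := -(z - w))
    (a12 := -(2 * η))
  simp only [odd] at k
  linear_combination (norm := skip) ((-1) * jacobiTheta1 (2 * η) τ / (jacobiTheta1 (w - 2 * η) τ * jacobiTheta1 (z - w - 2 * η) τ * jacobiTheta1 (z - 2 * η) τ * jacobiTheta1 (l) τ * jacobiTheta1 (l) τ)) * k
  field_simp
  try ring

theorem dybe7 (τ η z w l lm : ℂ) (hτ : 0 < τ.im) (hlm : lm = l - 2 * η)
    (h1 : jacobiTheta1 l τ ≠ 0) (h3 : jacobiTheta1 (l - 2 * η) τ ≠ 0)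
    (h7 : jacobiTheta1 (z - w - 2 * η) τ ≠ 0) (h8 : jacobiTheta1 (z - 2 * η) τ ≠ 0)
    (h9 : jacobiTheta1 (w - 2 * η) τ ≠ 0) :
    betaRM τ η (z - w) (-lm) * betaRM τ η w (-lm) + alphaRM τ η (z - w) (-lm) * betaRM τ η z (-l) * alphaRM τ η w lm =
      betaRM τ η z (-lm) := by
  subst hlm
  have odd := th1_odd τ l hτ h1
  rw [betaRM_eq τ η (z - w) (-(l - 2 * η)) (-(l - z + w - 2 * η)) (-(l - 2 * η)) (z - w - 2 * η)]
  rw [betaRM_eq τ η w (-(l - 2 * η)) (-(l - w - 2 * η)) (-(l - 2 * η)) (w - 2 * η)]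
  rw [alphaRM_eq τ η (z - w) (-(l - 2 * η)) (-(l - 2 * (2 * η))) (-(l - 2 * η)) (z - w - 2 * η)]
  rw [betaRM_eq τ η z (-l) (-(l - z)) (-(l)) (z - 2 * η)]
  rw [alphaRM_eq τ η w (l - 2 * η) (l) (l - 2 * η) (w - 2 * η)]
  rw [betaRM_eq τ η z (-(l - 2 * η)) (-(l - z - 2 * η)) (-(l - 2 * η)) (z - 2 * η)]
  try simp only [odd]
  have k := th1_tt τ hτ ((1/2) * z) (-((1/2) * z) + 2 * η) (l - (1/2) * z - 2 * η) (-((1/2) * z) + w)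
    (a1 := 2 * η)
    (a2 := z - 2 * η)
    (a3 := l - z + w - 2 * η)
    (a4 := l - w - 2 * η)
    (a5 := w)
    (a6 := z - w)
    (a7 := l - z)
    (a8 := l - 2 * (2 * η))
    (a9 := l - 2 * η)
    (a10 := -(l - z - 2 * η))
    (a11 := -(z - w - 2 * η))
    (a12 := -(w - 2 * η))
  simp only [odd] at k
  linear_combination (norm := skip) ((1) * jacobiTheta1 (2 * η) τ / (jacobiTheta1 (w - 2 * η) τ * jacobiTheta1 (z - w - 2 * η) τ * jacobiTheta1 (z - 2 * η) τ * jacobiTheta1 (l - 2 * η) τ * jacobiTheta1 (l - 2 * η) τ)) * k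
  field_simp
  try ring

theorem dybe8 (τ η z w l lm : ℂ) (hτ : 0 < τ.im) (hlm : lm = l - 2 * η)
    (h1 : jacobiTheta1 l τ ≠ 0) (h3 : jacobiTheta1 (l - 2 * η) τ ≠ 0)
    (h7 : jacobiTheta1 (z - w - 2 * η) τ ≠ 0) (h8 : jacobiTheta1 (z - 2 * η) τ ≠ 0)
    (h9 : jacobiTheta1 (w - 2 * η) τ ≠ 0) :
    betaRM τ η (z - w) (-lm) * alphaRM τ η w (-lm) + alphaRM τ η (z - w) (-lm) * betaRM τ η z (-l) * betaRM τ η w lm =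
      alphaRM τ η z (-lm) * betaRM τ η (z - w) (-l) := by
  subst hlm
  have odd := th1_odd τ l hτ h1
  rw [betaRM_eq τ η (z - w) (-(l - 2 * η)) (-(l - z + w - 2 * η)) (-(l - 2 * η)) (z - w - 2 * η)]
  rw [alphaRM_eq τ η w (-(l - 2 * η)) (-(l - 2 * (2 * η))) (-(l - 2 * η)) (w - 2 * η)]
  rw [alphaRM_eq τ η (z - w) (-(l - 2 * η)) (-(l - 2 * (2 * η))) (-(l - 2 * η)) (z - w - 2 * η)]
  rw [betaRM_eq τ η z (-l) (-(l - z)) (-(l)) (z - 2 * η)]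
  rw [betaRM_eq τ η w (l - 2 * η) (l + w - 2 * η) (l - 2 * η) (w - 2 * η)]
  rw [alphaRM_eq τ η z (-(l - 2 * η)) (-(l - 2 * (2 * η))) (-(l - 2 * η)) (z - 2 * η)]
  rw [betaRM_eq τ η (z - w) (-l) (-(l - z + w)) (-(l)) (z - w - 2 * η)]
  try simp only [odd]
  have k := th1_tt τ hτ ((1/2) * z + (1/2) * w - (1/2) * (2 * η)) (-((1/2) * z) + (1/2) * w + (1/2) * (2 * η)) (l - (1/2) * z + (1/2) * w - (1/2) * (2 * η)) (-((1/2) * z) + (1/2) * w - (1/2) * (2 * η))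
    (a1 := w)
    (a2 := z - 2 * η)
    (a3 := l - z + w - 2 * η)
    (a4 := l)
    (a5 := w - 2 * η)
    (a6 := z)
    (a7 := l - z + w)
    (a8 := l - 2 * η)
    (a9 := l + w - 2 * η)
    (a10 := -(l - z))
    (a11 := -(z - w))
    (a12 := 2 * η)
  simp only [odd] at k
  linear_combination (norm := skip) ((-1) * jacobiTheta1 (2 * η) τ * jacobiTheta1 (l - 2 * (2 * η)) τ / (jacobiTheta1 (w - 2 * η) τ * jacobiTheta1 (z - w - 2 * η) τ * jacobiTheta1 (z - 2 * η) τ * jacobiTheta1 (l - 2 * η) τ * jacobiTheta1 (l - 2 * η) τ * jacobiTheta1 (l) τ)) * k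
  field_simp
  try ring

theorem dybe9 (τ η z w l lm : ℂ) (hτ : 0 < τ.im) (hlm : lm = l - 2 * η)
    (h1 : jacobiTheta1 l τ ≠ 0) (h3 : jacobiTheta1 (l - 2 * η) τ ≠ 0)
    (h7 : jacobiTheta1 (z - w - 2 * η) τ ≠ 0) (h8 : jacobiTheta1 (z - 2 * η) τ ≠ 0)
    (h9 : jacobiTheta1 (w - 2 * η) τ ≠ 0) :
    alphaRM τ η (z - w) (-lm) * alphaRM τ η z (-l) =
      alphaRM τ η z (-lm) * alphaRM τ η (z - w) (-l) := by
  subst hlm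
  have odd := th1_odd τ l hτ h1
  rw [alphaRM_eq τ η (z - w) (-(l - 2 * η)) (-(l - 2 * (2 * η))) (-(l - 2 * η)) (z - w - 2 * η)]
  rw [alphaRM_eq τ η z (-l) (-(l - 2 * η)) (-(l)) (z - 2 * η)]
  rw [alphaRM_eq τ η z (-(l - 2 * η)) (-(l - 2 * (2 * η))) (-(l - 2 * η)) (z - 2 * η)]
  rw [alphaRM_eq τ η (z - w) (-l) (-(l - 2 * η)) (-(l)) (z - w - 2 * η)]
  try simp only [odd]
  field_simp

set_option maxHeartbeats 4000000 in
/-- **Dynamical Yang–Baxter equation** for the fundamental R-matrix: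
`R⁽¹²⁾(z−w,λ−2ηh⁽³⁾) R⁽¹³⁾(z,λ) R⁽²³⁾(w,λ−2ηh⁽¹⁾)
 = R⁽²³⁾(w,λ) R⁽¹³⁾(z,λ−2ηh⁽²⁾) R⁽¹²⁾(z−w,λ)`,
where `e_j` has `h`-weight `1−2j`. -/
theorem fundR_dynamical_Yang_Baxter (τ η z w lam : ℂ) (hτ : 0 < τ.im)
    (h1 : jacobiTheta1 lam τ ≠ 0) (h2 : jacobiTheta1 (-lam) τ ≠ 0)
    (h3 : jacobiTheta1 (lam - 2 * η) τ ≠ 0) (h4 : jacobiTheta1 (-(lam - 2 * η)) τ ≠ 0)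
    (h5 : jacobiTheta1 (lam + 2 * η) τ ≠ 0) (h6 : jacobiTheta1 (-(lam + 2 * η)) τ ≠ 0)
    (h7 : jacobiTheta1 (z - w - 2 * η) τ ≠ 0) (h8 : jacobiTheta1 (z - 2 * η) τ ≠ 0)
    (h9 : jacobiTheta1 (w - 2 * η) τ ≠ 0) :
    Rop12 τ η (z - w) (fun s => lam - 2 * η * (1 - 2 * ((s : ℕ) : ℂ))) *
        Rop13 τ η z (fun _ => lam) *
        Rop23 τ η w (fun s => lam - 2 * η * (1 - 2 * ((s : ℕ) : ℂ))) =
      Rop23 τ η w (fun _ => lam) *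
        Rop13 τ η z (fun s => lam - 2 * η * (1 - 2 * ((s : ℕ) : ℂ))) *
        Rop12 τ η (z - w) (fun _ => lam) := by
  have h6n : jacobiTheta1 (-lam - 2 * η) τ ≠ 0 := by
    rwa [show -lam - 2 * η = -(lam + 2 * η) by ring]
  have hf : (fun s : Fin 2 => lam - 2 * η * (1 - 2 * ((s : ℕ) : ℂ))) =
      ![lam - 2 * η, lam + 2 * η] := by
    funext s; fin_cases s
    · simp
    · simp; ring
  rw [hf]
  obtain ⟨lm, hm⟩ : ∃ lm, lm = lam - 2 * η := ⟨_, rfl⟩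
  obtain ⟨lp, hp⟩ : ∃ lp, lp = lam + 2 * η := ⟨_, rfl⟩
  have p1 := dybe1 τ η z w lam lm hτ hm h1 h3 h7 h8 h9
  have p2 := dybe2 τ η z w lam lm hτ hm h1 h3 h7 h8 h9
  have p3 := dybe3 τ η z w lam lm hτ hm h1 h3 h7 h8 h9
  have p4 := dybe4 τ η z w lam lm hτ hm h1 h3 h7 h8 h9
  have p5 := dybe5 τ η z w lam lm hτ hm h1 h3 h7 h8 h9
  have p6 := dybe6 τ η z w lam lm hτ hm h1 h3 h7 h8 h9
  have p7 := dybe7 τ η z w lam lm hτ hm h1 h3 h7 h8 h9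
  have p8 := dybe8 τ η z w lam lm hτ hm h1 h3 h7 h8 h9
  have p9 := dybe9 τ η z w lam lm hτ hm h1 h3 h7 h8 h9
  have q1 := dybe1 τ η z w (-lam) (-lp) hτ (by rw [hp]; ring) h2 h6n h7 h8 h9
  have q2 := dybe2 τ η z w (-lam) (-lp) hτ (by rw [hp]; ring) h2 h6n h7 h8 h9
  have q3 := dybe3 τ η z w (-lam) (-lp) hτ (by rw [hp]; ring) h2 h6n h7 h8 h9
  have q4 := dybe4 τ η z w (-lam) (-lp) hτ (by rw [hp]; ring) h2 h6n h7 h8 h9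
  have q5 := dybe5 τ η z w (-lam) (-lp) hτ (by rw [hp]; ring) h2 h6n h7 h8 h9
  have q6 := dybe6 τ η z w (-lam) (-lp) hτ (by rw [hp]; ring) h2 h6n h7 h8 h9
  have q7 := dybe7 τ η z w (-lam) (-lp) hτ (by rw [hp]; ring) h2 h6n h7 h8 h9
  have q8 := dybe8 τ η z w (-lam) (-lp) hτ (by rw [hp]; ring) h2 h6n h7 h8 h9
  have q9 := dybe9 τ η z w (-lam) (-lp) hτ (by rw [hp]; ring) h2 h6n h7 h8 h9
  simp only [neg_neg] at q1 q2 q3 q4 q5 q6 q7 q8 q9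
  rw [← hm, ← hp]
  ext ⟨b1, b2, b3⟩ ⟨c1, c2, c3⟩
  fin_cases b1 <;> fin_cases b2 <;> fin_cases b3 <;>
    fin_cases c1 <;> fin_cases c2 <;> fin_cases c3 <;>
    simp only [Matrix.mul_apply, Fintype.sum_prod_type, Fin.sum_univ_two, Rop12, Rop13, Rop23,
      fundR, Prod.mk.injEq, Fin.zero_eta, Fin.mk_one, zero_ne_one, one_ne_zero, and_true, true_and,
      and_false, false_and, and_self, if_true, if_false, Matrix.cons_val_zero,
      Matrix.cons_val_one, mul_zero, zero_mul, mul_one, one_mul, add_zero, zero_add] <;>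
    first | done | linear_combination p1 | linear_combination p2 | linear_combination p3 | linear_combination p4 | linear_combination p5 | linear_combination p6 | linear_combination p7 | linear_combination p8 | linear_combination p9 | linear_combination q1 | linear_combination q2 | linear_combination q3 | linear_combination q4 | linear_combination q5 | linear_combination q6 | linear_combination q7 | linear_combination q8 | linear_combination q9
end

section
/- Let τ ∈ ℂ with Im τ > 0 and η ∈ ℂ. The fundamental R-matrix satisfies unitarity: for all z, λ ∈ ℂ at which all entries are defined, R(z,λ) ∘ (P ∘ R(−z,λ) ∘ P) = Id on ℂ²⊗ℂ², where P is the flip P(u⊗v) = v⊗u. -/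
open Complex

/-- The flip matrix `P(u⊗v) = v⊗u` on `ℂ²⊗ℂ²`. -/
def flipP : Matrix (Fin 2 × Fin 2) (Fin 2 × Fin 2) ℂ := fun b c =>
  if b.1 = c.2 ∧ b.2 = c.1 then 1 else 0


/-- Exponential terms of the half-period theta sums. -/
noncomputable def thTerm (τ c x : ℂ) (a : ℤ) : ℂ :=
  Complex.exp (Real.pi * I * τ * (2 * a + c) ^ 2 / 2 + 2 * Real.pi * I * (2 * a + c) * x)

noncomputable def th1Term (t τ : ℂ) (j : ℤ) : ℂ :=
  Complex.exp (Real.pi * I * (j + 1/2) ^ 2 * τ + 2 * Real.pi * I * (j + 1/2) * (t + 1/2))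

lemma summable_thTerm (τ c x : ℂ) (hτ : 0 < τ.im) : Summable (fun a => ‖thTerm τ c x a‖) := by
  have h2 : 0 < (2 * τ).im := by simpa using hτ
  have h := ((summable_jacobiTheta₂_term_iff (2 * x + c * τ) (2 * τ)).2 h2).mul_left
    (Complex.exp (Real.pi * I * τ * c ^ 2 / 2 + 2 * Real.pi * I * c * x))
  refine (h.congr fun a => ?_).norm
  rw [jacobiTheta₂_term, thTerm, ← Complex.exp_add]
  congr 1
  ring

lemma summable_th1Term (t τ : ℂ) (hτ : 0 < τ.im) : Summable (fun a => ‖th1Term t τ a‖) := by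
  have h := ((summable_jacobiTheta₂_term_iff (t + 1/2 + τ / 2) τ).2 hτ).mul_left
    (Complex.exp (Real.pi * I * τ / 4 + Real.pi * I * (t + 1/2)))
  refine (h.congr fun a => ?_).norm
  rw [jacobiTheta₂_term, th1Term, ← Complex.exp_add]
  congr 1
  ring

/-- Reindexing of pairs of integers by parity of the difference. -/
def parMap : (ℤ × ℤ) ⊕ (ℤ × ℤ) → ℤ × ℤ :=
  Sum.elim (fun p => (p.1 + p.2, p.1 - p.2 - 1)) (fun p => (p.1 + p.2, p.1 - p.2))

lemma parMap_bij : Function.Bijective parMap := by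
  constructor
  · rintro (⟨a, b⟩ | ⟨a, b⟩) (⟨c, d⟩ | ⟨c, d⟩) h <;>
      simp only [parMap, Sum.elim_inl, Sum.elim_inr, Prod.mk.injEq] at h <;>
      simp only [Sum.inl.injEq, Sum.inr.injEq, Prod.mk.injEq, reduceCtorEq] <;> omega
  · rintro ⟨m, n⟩
    rcases Int.even_or_odd' (m - n) with ⟨k, hk | hk⟩
    · exact ⟨Sum.inr (n + k, k), by simp only [parMap, Sum.elim_inr, Prod.mk.injEq]; omega⟩
    · exact ⟨Sum.inl (n + k + 1, k), by simp only [parMap, Sum.elim_inl, Prod.mk.injEq]; omega⟩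

lemma exp_odd (k : ℤ) : Complex.exp (Real.pi * I * (2 * k + 1)) = -1 := by
  have : Real.pi * I * (2 * k + 1) = k * (2 * Real.pi * I) + Real.pi * I := by ring
  rw [this, Complex.exp_add, Complex.exp_int_mul_two_pi_mul_I, Complex.exp_pi_mul_I, one_mul]

lemma exp_even (k : ℤ) : Complex.exp (Real.pi * I * (2 * k)) = 1 := by
  have : Real.pi * I * (2 * k) = k * (2 * Real.pi * I) := by ring
  rw [this, Complex.exp_int_mul_two_pi_mul_I]

lemma term_even (τ x y : ℂ) (a b : ℤ) :
    th1Term (x + y) τ (a + b) * th1Term (x - y) τ (a - b - 1)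
      = thTerm τ 0 x a * thTerm τ 1 y b := by
  have h : thTerm τ 0 x a * thTerm τ 1 y b
      = thTerm τ 0 x a * thTerm τ 1 y b * Complex.exp (Real.pi * I * (2 * a)) := by
    rw [exp_even, mul_one]
  rw [h]
  simp only [th1Term, thTerm, ← Complex.exp_add]
  congr 1
  push_cast
  ring

lemma term_odd (τ x y : ℂ) (a b : ℤ) :
    th1Term (x + y) τ (a + b) * th1Term (x - y) τ (a - b)
      = -(thTerm τ 1 x a * thTerm τ 0 y b) := by
  rw [← mul_neg_one (thTerm τ 1 x a * thTerm τ 0 y b), ← exp_odd a]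
  simp only [th1Term, thTerm, ← Complex.exp_add]
  congr 1
  push_cast
  ring

lemma hasSum_congr_aux {f g : ℤ × ℤ → ℂ} {s : ℂ} (h : HasSum f s) (e : ∀ p, g p = f p) :
    HasSum g s := by
  rwa [funext e]

lemma theta_prod (τ x y : ℂ) (hτ : 0 < τ.im) :
    jacobiTheta1 (x + y) τ * jacobiTheta1 (x - y) τ =
      (∑' a, thTerm τ 0 x a) * (∑' a, thTerm τ 1 y a)
        - (∑' a, thTerm τ 1 x a) * (∑' a, thTerm τ 0 y a) := by
  have e1 : jacobiTheta1 (x + y) τ * jacobiTheta1 (x - y) τ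
      = (∑' j, th1Term (x + y) τ j) * (∑' j, th1Term (x - y) τ j) := by
    simp only [jacobiTheta1, th1Term, neg_mul_neg]
  have sx := fun c => summable_thTerm τ c x hτ
  have sy := fun c => summable_thTerm τ c y hτ
  have s1 := summable_th1Term (x + y) τ hτ
  have s2 := summable_th1Term (x - y) τ hτ
  rw [e1, tsum_mul_tsum_of_summable_norm s1 s2, tsum_mul_tsum_of_summable_norm (sx 0) (sy 1),
    tsum_mul_tsum_of_summable_norm (sx 1) (sy 0)]
  have hl := (summable_mul_of_summable_norm (sx 0) (sy 1)).hasSum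
  have hr := (summable_mul_of_summable_norm (sx 1) (sy 0)).hasSum.neg
  rw [← (Equiv.ofBijective parMap parMap_bij).tsum_eq, sub_eq_add_neg (∑' _, _)]
  refine HasSum.tsum_eq (HasSum.sum ?_ ?_)
  · refine hasSum_congr_aux hl fun p => term_even τ x y p.1 p.2
  · refine hasSum_congr_aux hr fun p => term_odd τ x y p.1 p.2

lemma theta_odd (τ s d : ℂ) (hτ : 0 < τ.im) (hs : jacobiTheta1 s τ ≠ 0) :
    jacobiTheta1 (-d) τ = - jacobiTheta1 d τ := by
  have h1 := theta_prod τ ((s + d) / 2) ((s - d) / 2) hτ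
  have h2 := theta_prod τ ((s - d) / 2) ((s + d) / 2) hτ
  rw [show (s + d) / 2 + (s - d) / 2 = s by ring, show (s + d) / 2 - (s - d) / 2 = d by ring] at h1
  rw [show (s - d) / 2 + (s + d) / 2 = s by ring,
    show (s - d) / 2 - (s + d) / 2 = -d by ring] at h2
  apply mul_left_cancel₀ hs
  rw [h2, mul_neg, h1]
  ring

lemma theta_three (τ l z w : ℂ) (hτ : 0 < τ.im) :
    jacobiTheta1 (l + w) τ * jacobiTheta1 (l - w) τ * jacobiTheta1 z τ ^ 2
      - jacobiTheta1 (l + z) τ * jacobiTheta1 (l - z) τ * jacobiTheta1 w τ ^ 2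
      = jacobiTheta1 l τ ^ 2 * (jacobiTheta1 (z + w) τ * jacobiTheta1 (z - w) τ) := by
  have sq : ∀ u, jacobiTheta1 u τ ^ 2 = jacobiTheta1 (u + 0) τ * jacobiTheta1 (u - 0) τ := by
    intro u
    rw [add_zero, sub_zero, sq]
  rw [sq z, sq w, sq l]
  simp only [theta_prod _ _ _ hτ]
  ring

lemma diag_entry (τ η z l : ℂ) (hτ : 0 < τ.im) (h1 : jacobiTheta1 l τ ≠ 0)
    (h3 : jacobiTheta1 (z - 2 * η) τ ≠ 0) (h4 : jacobiTheta1 (-z - 2 * η) τ ≠ 0) :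
    alphaRM τ η z l * alphaRM τ η (-z) (-l) + betaRM τ η z l * betaRM τ η (-z) l = 1 := by
  have od := fun d => theta_odd τ l d hτ h1
  have key := theta_three τ l z (2 * η) hτ
  have e4 : -z - 2 * η = -(z + 2 * η) := by ring
  have e5 : -l + 2 * η = -(l - 2 * η) := by ring
  rw [e4, od, neg_ne_zero] at h4
  simp only [alphaRM, betaRM, e4, e5, od, ← sub_eq_add_neg]
  field_simp
  linear_combination key

lemma off_entry (τ η z l : ℂ) (hτ : 0 < τ.im) (h1 : jacobiTheta1 l τ ≠ 0) :
    alphaRM τ η z l * betaRM τ η (-z) (-l) + betaRM τ η z l * alphaRM τ η (-z) l = 0 := by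
  have od := fun d => theta_odd τ l d hτ h1
  have e5 : -l + -z = -(l + z) := by ring
  simp only [alphaRM, betaRM, e5, od]
  ring

/-- **Unitarity of the fundamental R-matrix**:
`R(z,λ) ∘ (P ∘ R(−z,λ) ∘ P) = Id` on `ℂ²⊗ℂ²`. -/
theorem fundR_unitarity (τ η z lam : ℂ) (hτ : 0 < τ.im)
    (h1 : jacobiTheta1 lam τ ≠ 0) (h2 : jacobiTheta1 (-lam) τ ≠ 0)
    (h3 : jacobiTheta1 (z - 2 * η) τ ≠ 0) (h4 : jacobiTheta1 (-z - 2 * η) τ ≠ 0) :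
    fundR τ η z lam * (flipP * fundR τ η (-z) lam * flipP) = 1 := by
  have d1 := diag_entry τ η z lam hτ h1 h3 h4
  have d2 := diag_entry τ η z (-lam) hτ h2 h3 h4
  have o1 := off_entry τ η z lam hτ h1
  have o2 := off_entry τ η z (-lam) hτ h2
  rw [neg_neg] at d2 o2
  ext ⟨i, j⟩ ⟨k, l⟩
  fin_cases i <;> fin_cases j <;> fin_cases k <;> fin_cases l <;>
    simp [Matrix.mul_apply, Fintype.sum_prod_type, fundR, flipP] <;>
    first
      | linear_combination d1
      | linear_combination d2
      | linear_combination o1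
      | linear_combination o2
end

section
/- Let τ ∈ ℂ with Im τ > 0 and η, Λ, M ∈ ℂ. Assign to the two one-excitation basis vectors the weight pairs w(e₀⊗e₁) = (Λ, M−2) and w(e₁⊗e₀) = (Λ−2, M), and write w(k,l) = (w₁(k,l), w₂(k,l)) for the weight pair of e_k⊗e_l. Then for all z, λ where both sides are defined and for all index pairs (k,l), (i,j) with k+l = i+j = 1: R^{kl}_{ij}(z+τ, λ; Λ, M) = e^{−2πiηΛM} · [α(λ−2η w₂(k,l)) / α(λ−2η(Λ+M−2))] · R^{kl}_{ij}(z, λ; Λ, M) · [α(λ−2η w₁(i,j)) / α(λ)], where α(λ) = exp(−πiλ²/(4η)). (This is the transformation R_{Λ,M}(z+τ,λ) = e^{−2πiηΛM} · (α(λ−2ηh^{(2)})/α(λ−2η(h^{(1)}+h^{(2)}))) · R_{Λ,M}(z,λ) · (α(λ−2ηh^{(1)})/α(λ)) on the one-excitation subspace.) -/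
open Complex

/-- One-excitation R-matrix entries `R^{kl}_{ij}(z,λ;Λ,M)` (modulus `τ`,
Planck constant `η`); zero outside the weight-one index pairs. -/
noncomputable def Rone (τ η Λ M z lam : ℂ) (k l i j : Fin 2) : ℂ :=
  if k = 0 ∧ l = 1 then
    (if i = 0 ∧ j = 1 then
      jacobiTheta1 (z + η * Λ - η * M) τ * jacobiTheta1 (lam + 2 * η) τ /
        (jacobiTheta1 (z - η * Λ - η * M) τ * jacobiTheta1 (lam + 2 * η * (1 - Λ)) τ)
    else if i = 1 ∧ j = 0 then
      -(jacobiTheta1 (lam + 2 * η + z - η * Λ - η * M) τ * jacobiTheta1 (2 * η * Λ) τ /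
        (jacobiTheta1 (z - η * Λ - η * M) τ * jacobiTheta1 (lam + 2 * η * (1 - Λ)) τ))
    else 0)
  else if k = 1 ∧ l = 0 then
    (if i = 0 ∧ j = 1 then
      -(jacobiTheta1 (lam + 2 * η - z - η * Λ - η * M) τ * jacobiTheta1 (2 * η * M) τ /
        (jacobiTheta1 (z - η * Λ - η * M) τ * jacobiTheta1 (lam + 2 * η * (1 - Λ)) τ))
    else if i = 1 ∧ j = 0 then
      jacobiTheta1 (z + η * M - η * Λ) τ * jacobiTheta1 (lam + 2 * η * (1 - Λ - M)) τ /
        (jacobiTheta1 (z - η * Λ - η * M) τ * jacobiTheta1 (lam + 2 * η * (1 - Λ)) τ)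
    else 0)
  else 0


noncomputable def alphaFn (eta lam : ℂ) : ℂ :=
  Complex.exp (-(Real.pi * I * lam ^ 2) / (4 * eta))

theorem jt1_add (t τ : ℂ) :
    jacobiTheta1 (t + τ) τ =
      -(Complex.exp (-(Real.pi * I * τ) - 2 * Real.pi * I * t) * jacobiTheta1 t τ) := by
  unfold jacobiTheta1
  rw [← (Equiv.addRight (1 : ℤ)).tsum_eq (fun j : ℤ =>
    Complex.exp (Real.pi * I * (j + 1/2) ^ 2 * τ + 2 * Real.pi * I * (j + 1/2) * (t + 1/2)))]
  rw [mul_neg, neg_neg, ← tsum_mul_left, ← tsum_neg]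
  refine tsum_congr fun j => ?_
  have h : ∀ x : ℂ, -Complex.exp x = Complex.exp (x - Real.pi * I) := by
    intro x
    rw [Complex.exp_sub, Complex.exp_pi_mul_I]; ring
  rw [h, ← Complex.exp_add, Equiv.coe_addRight, Complex.exp_eq_exp_iff_exists_int]
  refine ⟨-(j + 1) - 1 + j + 1, ?_⟩
  push_cast
  ring

theorem jt1_sub (t τ : ℂ) :
    jacobiTheta1 (t - τ) τ =
      -(Complex.exp (-(Real.pi * I * τ) + 2 * Real.pi * I * t) * jacobiTheta1 t τ) := by
  have h := jt1_add (t - τ) τ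
  rw [sub_add_cancel] at h
  rw [h, mul_neg, neg_neg, ← mul_assoc, ← Complex.exp_add]
  ring_nf
  simp

/-- The common division step. -/
theorem ratio_step (A B C D a b c : ℂ) (h : a = c + b) :
    -(Complex.exp a * A) * B / (-(Complex.exp b * C) * D) =
      Complex.exp c * (A * B / (C * D)) := by
  rw [h, Complex.exp_add]
  have := Complex.exp_ne_zero b
  by_cases hC : C = 0
  · simp [hC]
  by_cases hD : D = 0
  · simp [hD]
  field_simp

theorem alpha_step (P Q R S E X c : ℂ) (h : c = E + (P - Q) + (R - S)) :
    Complex.exp E * (Complex.exp P / Complex.exp Q) * X * (Complex.exp R / Complex.exp S) =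
      Complex.exp c * X := by
  rw [← Complex.exp_sub, ← Complex.exp_sub, h, Complex.exp_add, Complex.exp_add]
  ring

/-- Transformation of the one-excitation R-matrix under the shift `z → z + τ`:
`R_{Λ,M}(z+τ,λ) = e^{−2πiηΛM} (α(λ−2ηh⁽²⁾)/α(λ−2η(h⁽¹⁾+h⁽²⁾))) R_{Λ,M}(z,λ)
(α(λ−2ηh⁽¹⁾)/α(λ))` where the one-excitation weight pairs are
`w(e₀⊗e₁) = (Λ, M−2)` and `w(e₁⊗e₀) = (Λ−2, M)`. -/
theorem Rone_shift_z_tau (τ η Λ M z lam : ℂ) (hτ : 0 < τ.im) (hη : η ≠ 0)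
    (hd1 : jacobiTheta1 (z + τ - η * Λ - η * M) τ ≠ 0)
    (hd2 : jacobiTheta1 (z - η * Λ - η * M) τ ≠ 0)
    (hd3 : jacobiTheta1 (lam + 2 * η * (1 - Λ)) τ ≠ 0) :
    ∀ k l i j : Fin 2, (k : ℕ) + (l : ℕ) = 1 → (i : ℕ) + (j : ℕ) = 1 →
      Rone τ η Λ M (z + τ) lam k l i j =
        Complex.exp (-(2 * Real.pi * I * η * Λ * M)) *
          (alphaFn η (lam - 2 * η * (if k = 0 then M - 2 else M)) /
            alphaFn η (lam - 2 * η * (Λ + M - 2))) *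
          Rone τ η Λ M z lam k l i j *
          (alphaFn η (lam - 2 * η * (if i = 0 then Λ else Λ - 2)) / alphaFn η lam) := by
  intro k l i j hkl hij
  have e1 : z + τ - η * Λ - η * M = (z - η * Λ - η * M) + τ := by ring
  have e2 : z + τ + η * Λ - η * M = (z + η * Λ - η * M) + τ := by ring
  have e3 : lam + 2 * η + (z + τ) - η * Λ - η * M
    = (lam + 2 * η + z - η * Λ - η * M) + τ := by ring
  have e4 : lam + 2 * η - (z + τ) - η * Λ - η * M
    = (lam + 2 * η - z - η * Λ - η * M) - τ := by ring
  have e5 : z + τ + η * M - η * Λ = (z + η * M - η * Λ) + τ := by ring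
  fin_cases k <;> fin_cases l <;> simp at hkl <;> fin_cases i <;> fin_cases j <;> simp at hij
  all_goals
    simp only [Rone, alphaFn, e1, e2, e3, e4, e5, jt1_add, jt1_sub]
    simp only [Fin.zero_eta, Fin.mk_one, Fin.isValue, and_self, if_true, if_false, one_ne_zero,
      zero_ne_one, and_false, false_and]
  · rw [ratio_step (c := -(4 * Real.pi * I * η * Λ)) (h := by ring)]
    exact (alpha_step _ _ _ _ _ _ _ (by field_simp; ring)).symm
  · rw [ratio_step (c := -(2 * Real.pi * I * (lam + 2 * η))) (h := by ring)]
    rw [← mul_neg]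
    exact (alpha_step _ _ _ _ _ _ _ (by field_simp; ring)).symm
  · rw [ratio_step (c := 2 * Real.pi * I * (lam + 2 * η - 2 * η * Λ - 2 * η * M)) (h := by ring)]
    rw [← mul_neg]
    exact (alpha_step _ _ _ _ _ _ _ (by field_simp; ring)).symm
  · rw [ratio_step (c := -(4 * Real.pi * I * η * M)) (h := by ring)]
    exact (alpha_step _ _ _ _ _ _ _ (by field_simp; ring)).symm
end
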